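/- For any bipartite quantum state ρ_AB and any local POVM measurements on A and B, the classical mutual information of the joint outcome distribution is at most the quantum mutual information S(A:B) = S(ρ_A) + S(ρ_B) − S(ρ_AB). -/

import Mathlib

open Matrix BigOperators
open scoped Kronecker Classical ComplexOrder

noncomputable section

/-- Shannon entropy (base 2, with 0 log 0 = 0). -/
def shannon {ι : Type*} [Fintype ι] (p : ι → ℝ) : ℝ :=
  -∑ i, p i * Real.logb 2 (p i)

/-- Classical mutual information of a joint distribution. -/
def cMutualInfo {ι κ : Type*} [Fintype ι] [Fintype κ] (p : ι → κ → ℝ) : ℝ :=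
  shannon (fun i => ∑ s, p i s) + shannon (fun s => ∑ i, p i s)
    - shannon (fun x : ι × κ => p x.1 x.2)

/-- Von Neumann entropy (base 2) via eigenvalues of a Hermitian matrix. -/
def vnEntropy {n : Type*} [Fintype n] [DecidableEq n] (ρ : Matrix n n ℂ) : ℝ :=
  if h : ρ.IsHermitian then shannon h.eigenvalues else 0

/-- Partial trace over the second (right) factor. -/
def ptraceR {a b : Type*} [Fintype a] [Fintype b] (ρ : Matrix (a × b) (a × b) ℂ) :
    Matrix a a ℂ := fun i j => ∑ k, ρ (i, k) (j, k)

/-- Partial trace over the first (left) factor. -/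
def ptraceL {a b : Type*} [Fintype a] [Fintype b] (ρ : Matrix (a × b) (a × b) ℂ) :
    Matrix b b ℂ := fun i j => ∑ k, ρ (k, i) (k, j)

def IsDensityMatrix {n : Type*} [Fintype n] (ρ : Matrix n n ℂ) : Prop :=
  ρ.PosSemidef ∧ ρ.trace = 1

def IsPOVM {n ι : Type*} [Fintype n] [Fintype ι] [DecidableEq n]
    (M : ι → Matrix n n ℂ) : Prop :=
  (∀ i, (M i).PosSemidef) ∧ ∑ i, M i = 1

/-- Quantum mutual information S(A:B). -/
def qMutualInfo {a b : Type*} [Fintype a] [Fintype b] [DecidableEq a] [DecidableEq b]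
    (ρ : Matrix (a × b) (a × b) ℂ) : ℝ :=
  vnEntropy (ptraceR ρ) + vnEntropy (ptraceL ρ) - vnEntropy ρ

/-- Joint outcome probability of local measurements. -/
def measProb {a b ι κ : Type*} [Fintype a] [Fintype b] [Fintype ι] [Fintype κ]
    (ρ : Matrix (a × b) (a × b) ℂ) (M : ι → Matrix a a ℂ) (N : κ → Matrix b b ℂ)
    (i : ι) (s : κ) : ℝ := ((M i ⊗ₖ N s) * ρ).trace.re
theorem hasDerivAt_mul_log_add_mul {P Q T : ℝ} (hP : 0 ≤ P) (hPQ : P ≠ 0 → 0 < Q)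
    (hT : 0 ≤ T) : HasDerivAt (fun t => P * Real.log (Q + t * P)) (P ^ 2 / (Q + T * P)) T := by
  rcases eq_or_ne P 0 with rfl | h
  · simpa using hasDerivAt_const T (0 : ℝ)
  · have hpos : 0 < Q + T * P := by have := hPQ h; positivity
    have h1 : HasDerivAt (fun t => Q + t * P) (1 * P) T :=
      ((hasDerivAt_id T).mul_const P).const_add Q
    exact ((h1.log hpos.ne').const_mul P).congr_deriv (by ring)

theorem tendsto_mul_log_add_mul_sub {P Q : ℝ} (hP : 0 ≤ P) (hPQ : P ≠ 0 → 0 < Q) :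
    Filter.Tendsto (fun t => P * Real.log (Q + t * P) - P * Real.log t) Filter.atTop
      (nhds (P * Real.log P)) := by
  rcases eq_or_ne P 0 with rfl | h
  · simp
  · have hQ := hPQ h
    have h1 : Filter.Tendsto (fun t : ℝ => Q / t + P) Filter.atTop (nhds (0 + P)) :=
      (tendsto_const_nhds.div_atTop Filter.tendsto_id).add_const P
    rw [zero_add] at h1
    refine ((h1.log h).const_mul P).congr' ?_
    filter_upwards [Filter.eventually_gt_atTop 0] with t ht
    have hpos : 0 < Q + t * P := by positivity
    rw [← mul_sub, ← Real.log_div hpos.ne' ht.ne']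
    congr 2
    field_simp

/-- Comparison of relative entropies of two pairs of distributions from the comparison of
`∑ P² / (Q + t P)` for all `t > 0`. -/
theorem relEntropy_le_of_sum_sq_div_le {X Y : Type*} [Fintype X] [Fintype Y]
    {P Q : X → ℝ} {p q : Y → ℝ}
    (hP : ∀ x, 0 ≤ P x) (hPQ : ∀ x, P x ≠ 0 → 0 < Q x)
    (hp : ∀ y, 0 ≤ p y) (hpq : ∀ y, p y ≠ 0 → 0 < q y)
    (hsum : ∑ x, P x = ∑ y, p y)
    (h : ∀ t, 0 < t → ∑ y, p y ^ 2 / (q y + t * p y) ≤ ∑ x, P x ^ 2 / (Q x + t * P x)) :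
    ∑ y, p y * (Real.log (p y) - Real.log (q y)) ≤
      ∑ x, P x * (Real.log (P x) - Real.log (Q x)) := by
  set g : ℝ → ℝ := fun t =>
    ∑ x, P x * Real.log (Q x + t * P x) - ∑ y, p y * Real.log (q y + t * p y) with hg
  have hd : ∀ t, 0 ≤ t → HasDerivAt g
      (∑ x, P x ^ 2 / (Q x + t * P x) - ∑ y, p y ^ 2 / (q y + t * p y)) t := fun t ht =>
    (HasDerivAt.fun_sum fun x _ => hasDerivAt_mul_log_add_mul (hP x) (hPQ x) ht).sub
      (HasDerivAt.fun_sum fun y _ => hasDerivAt_mul_log_add_mul (hp y) (hpq y) ht)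
  have hmono : MonotoneOn g (Set.Ici 0) := by
    refine monotoneOn_of_deriv_nonneg (convex_Ici 0)
      (fun t ht => (hd t ht).continuousAt.continuousWithinAt) ?_ ?_
    · intro t ht
      rw [interior_Ici] at ht
      exact (hd t (le_of_lt ht)).differentiableAt.differentiableWithinAt
    · intro t ht
      rw [interior_Ici] at ht
      rw [(hd t (le_of_lt ht)).deriv]
      exact sub_nonneg.2 (h t ht)
  have hlim : Filter.Tendsto g Filter.atTop
      (nhds (∑ x, P x * Real.log (P x) - ∑ y, p y * Real.log (p y))) := by
    have h1 := (tendsto_finsetSum Finset.univ fun x _ =>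
      tendsto_mul_log_add_mul_sub (hP x) (hPQ x)).sub
      (tendsto_finsetSum Finset.univ fun y _ => tendsto_mul_log_add_mul_sub (hp y) (hpq y))
    refine h1.congr fun t => ?_
    simp only [Finset.sum_sub_distrib, ← Finset.sum_mul, hsum, hg]
    ring
  have key : g 0 ≤ ∑ x, P x * Real.log (P x) - ∑ y, p y * Real.log (p y) :=
    ge_of_tendsto hlim <| (Filter.eventually_ge_atTop 0).mono fun t ht =>
      hmono Set.self_mem_Ici ht ht
  simp only [hg, zero_mul, add_zero] at key
  simp only [mul_sub, Finset.sum_sub_distrib]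
  linarith

theorem sum_mul_log_mul_marginals {X Y : Type*} [Fintype X] [Fintype Y] {p : X → Y → ℝ}
    {u : X → ℝ} {v : Y → ℝ} (hp : ∀ x y, 0 ≤ p x y)
    (hu : ∀ x, ∑ y, p x y = u x) (hv : ∀ y, ∑ x, p x y = v y) :
    ∑ z : X × Y, p z.1 z.2 * Real.log (u z.1 * v z.2) =
      ∑ x, u x * Real.log (u x) + ∑ y, v y * Real.log (v y) := by
  have h1 : ∀ x y, p x y * Real.log (u x * v y) =
      p x y * Real.log (u x) + p x y * Real.log (v y) := by
    intro x y
    rcases eq_or_ne (p x y) 0 with h | h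
    · simp [h]
    · have hpos : 0 < p x y := lt_of_le_of_ne (hp x y) h.symm
      have hx : 0 < u x := hu x ▸ hpos.trans_le
        (Finset.single_le_sum (fun y _ => hp x y) (Finset.mem_univ y))
      have hy : 0 < v y := hv y ▸ hpos.trans_le
        (Finset.single_le_sum (fun x _ => hp x y) (Finset.mem_univ x))
      rw [Real.log_mul hx.ne' hy.ne', mul_add]
  simp only [Fintype.sum_prod_type, h1, Finset.sum_add_distrib]
  congr 1
  · simp only [← Finset.sum_mul, hu]
  · rw [Finset.sum_comm]
    simp only [← Finset.sum_mul, hv]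

theorem shannon_eq {X : Type*} [Fintype X] (p : X → ℝ) :
    shannon p = -(∑ x, p x * Real.log (p x)) / Real.log 2 := by
  simp only [shannon, Real.logb, mul_div_assoc', Finset.sum_div, neg_div]

theorem spectral_eq {n : Type*} [Fintype n] [DecidableEq n] {A : Matrix n n ℂ}
    (hA : A.IsHermitian) : A = hA.eigenvectorUnitary *
      diagonal (fun j => (hA.eigenvalues j : ℂ)) * (hA.eigenvectorUnitary : Matrix n n ℂ)ᴴ := by
  conv_lhs => rw [hA.spectral_theorem]
  rfl

theorem trace_mul_nonneg {n : Type*} [Fintype n] [DecidableEq n] {A B : Matrix n n ℂ}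
    (hA : A.PosSemidef) (hB : B.PosSemidef) : 0 ≤ (A * B).trace := by
  rw [spectral_eq hB.isHermitian, ← Matrix.mul_assoc, ← Matrix.mul_assoc, Matrix.trace_mul_comm,
    ← Matrix.mul_assoc, ← Matrix.mul_assoc]
  simp only [trace, diag_apply, mul_diagonal]
  exact Finset.sum_nonneg fun j _ =>
    mul_nonneg (hA.conjTranspose_mul_mul_same _).diag_nonneg
      (Complex.zero_le_real.2 (hB.eigenvalues_nonneg j))

theorem trace_mul_re_nonneg {n : Type*} [Fintype n] [DecidableEq n] {A B : Matrix n n ℂ}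
    (hA : A.PosSemidef) (hB : B.PosSemidef) : 0 ≤ (A * B).trace.re :=
  (Complex.le_def.1 (trace_mul_nonneg hA hB)).1

/-- Kadison's inequality for the positive unital map given by a POVM. -/
theorem posSemidef_sum_sq_smul_sub_sq {n ι : Type*} [Fintype n] [Fintype ι] [DecidableEq n]
    {E : ι → Matrix n n ℂ} (hE : IsPOVM E) (x : ι → ℝ) :
    (∑ i, (x i ^ 2 : ℝ) • E i - (∑ i, x i • E i) * (∑ i, x i • E i)).PosSemidef := by
  set Y := ∑ i, x i • E i with hY
  have hYH : Yᴴ = Y := by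
    simp [hY, conjTranspose_sum, conjTranspose_smul, fun i => (hE.1 i).isHermitian.eq]
  have key : ∑ i, (x i ^ 2 : ℝ) • E i - Y * Y =
      ∑ i, (x i • (1 : Matrix n n ℂ) - Y) * E i * (x i • (1 : Matrix n n ℂ) - Y)ᴴ := by
    have h : ∀ i, (x i • (1 : Matrix n n ℂ) - Y) * E i * (x i • (1 : Matrix n n ℂ) - Y)ᴴ =
        (x i ^ 2 : ℝ) • E i - (x i • E i) * Y - Y * (x i • E i) + Y * E i * Y := by
      intro i
      simp only [conjTranspose_sub, conjTranspose_smul, conjTranspose_one, hYH, star_trivial,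
        sub_mul, mul_sub, smul_mul_assoc, mul_smul_comm, one_mul, mul_one, smul_sub, smul_smul,
        pow_two]
      abel
    simp only [h, Finset.sum_add_distrib, Finset.sum_sub_distrib, ← Finset.sum_mul,
      ← Finset.mul_sum, hE.2, ← hY, mul_one]
    abel
  rw [key]
  exact posSemidef_sum _ fun i _ => (hE.1 i).mul_mul_conjTranspose_same _

theorem two_mul_re_sub_le {l m t : ℝ} (hl : 0 ≤ l) (hm : 0 ≤ m) (ht : 0 < t) (w z : ℂ) :
    2 * (l * (star w * z).re) - (m + t * l) * Complex.normSq z ≤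
      Complex.normSq w * l ^ 2 / (m + t * l) := by
  have hd : 0 ≤ m + t * l := by positivity
  rcases hd.eq_or_lt with h | h
  · have : l = 0 := by nlinarith
    rw [← h, this]
    simp
  · rw [le_div_iff₀ h]
    simp only [Complex.normSq_apply, Complex.mul_re, Complex.star_def, Complex.conj_re,
      Complex.conj_im]
    nlinarith [sq_nonneg (l * w.re - (m + t * l) * z.re),
      sq_nonneg (l * w.im - (m + t * l) * z.im)]

theorem re_trace_conjTranspose_mul_mul_diagonal {n : Type*} [Fintype n] [DecidableEq n]
    (A B : Matrix n n ℂ) (d : n → ℝ) :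
    (Aᴴ * B * diagonal (fun j => (d j : ℂ))).trace.re =
      ∑ z : n × n, d z.2 * (star (A z.1 z.2) * B z.1 z.2).re := by
  rw [Fintype.sum_prod_type_right]
  simp only [trace, diag_apply, mul_diagonal, Complex.re_sum, Complex.re_mul_ofReal]
  simp only [mul_apply, conjTranspose_apply, Complex.re_sum, Finset.sum_mul, mul_comm (d _)]

theorem sum_sq_div_le_of_povm {n ι : Type*} [Fintype n] [Fintype ι] [DecidableEq n]
    {E : ι → Matrix n n ℂ} (hE : IsPOVM E) (U V : unitaryGroup n ℂ) {l m : n → ℝ}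
    (hl : ∀ j, 0 ≤ l j) (hm : ∀ k, 0 ≤ m k) {ρ σ : Matrix n n ℂ}
    (hρ : ρ = U * diagonal (fun j => (l j : ℂ)) * (U : Matrix n n ℂ)ᴴ)
    (hσ : σ = V * diagonal (fun k => (m k : ℂ)) * (V : Matrix n n ℂ)ᴴ) {t : ℝ} (ht : 0 < t) :
    ∑ i, (E i * ρ).trace.re ^ 2 / ((E i * σ).trace.re + t * (E i * ρ).trace.re) ≤
      ∑ z : n × n, Complex.normSq (((V : Matrix n n ℂ)ᴴ * U) z.1 z.2) * l z.2 ^ 2 /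
        (m z.1 + t * l z.2) := by
  have hUU : (U : Matrix n n ℂ) * (U : Matrix n n ℂ)ᴴ = 1 := mem_unitaryGroup_iff.1 U.2
  have hVV : (V : Matrix n n ℂ) * (V : Matrix n n ℂ)ᴴ = 1 := mem_unitaryGroup_iff.1 V.2
  have hρp : ρ.PosSemidef := by
    rw [hρ]
    exact (PosSemidef.diagonal fun j => by
      simpa using hl j).mul_mul_conjTranspose_same _
  have hσp : σ.PosSemidef := by
    rw [hσ]
    exact (PosSemidef.diagonal fun j => by
      simpa using hm j).mul_mul_conjTranspose_same _
  set p : ι → ℝ := fun i => (E i * ρ).trace.re with hp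
  set q : ι → ℝ := fun i => (E i * σ).trace.re with hq
  have hp0 : ∀ i, 0 ≤ p i := fun i => trace_mul_re_nonneg (hE.1 i) hρp
  have hq0 : ∀ i, 0 ≤ q i := fun i => trace_mul_re_nonneg (hE.1 i) hσp
  set x : ι → ℝ := fun i => p i / (q i + t * p i) with hx
  set Y := ∑ i, x i • E i with hY
  have hYH : Yᴴ = Y := by
    simp [hY, conjTranspose_sum, conjTranspose_smul, fun i => (hE.1 i).isHermitian.eq]
  set W := (V : Matrix n n ℂ)ᴴ * U with hW
  set Z := (V : Matrix n n ℂ)ᴴ * Y * U with hZ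
  have hzz : ∀ z : ℂ, (star z * z).re = Complex.normSq z := fun z => by
    rw [Complex.star_def, ← Complex.normSq_eq_conj_mul_self, Complex.ofReal_re]
  have h1 : ∑ z : n × n, l z.2 * (star (W z.1 z.2) * Z z.1 z.2).re = ∑ i, x i * p i := by
    have e1 : (Y * ρ).trace = (Wᴴ * Z * diagonal (fun j => (l j : ℂ))).trace := by
      rw [hρ, hW, hZ, conjTranspose_mul, conjTranspose_conjTranspose]
      rw [show (U : Matrix n n ℂ)ᴴ * V * ((V : Matrix n n ℂ)ᴴ * Y * U) =
        (U : Matrix n n ℂ)ᴴ * (V * (V : Matrix n n ℂ)ᴴ) * Y * U by simp only [Matrix.mul_assoc],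
        hVV, Matrix.mul_one, ← Matrix.mul_assoc, Matrix.trace_mul_comm]
      simp only [Matrix.mul_assoc]
    have e2 : (Y * ρ).trace.re = ∑ i, x i * p i := by
      simp [hY, Finset.sum_mul, trace_sum, hp]
    rw [← e2, e1, re_trace_conjTranspose_mul_mul_diagonal]
  have h2 : ∑ z : n × n, m z.1 * Complex.normSq (Z z.1 z.2) = (Y * Y * σ).trace.re := by
    have e1 : (Y * Y * σ).trace = (Zᴴᴴ * Zᴴ * diagonal (fun j => (m j : ℂ))).trace := by
      rw [conjTranspose_conjTranspose, hσ, hZ, conjTranspose_mul, conjTranspose_mul, conjTranspose_conjTranspose, hYH]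
      rw [show (V : Matrix n n ℂ)ᴴ * Y * U * ((U : Matrix n n ℂ)ᴴ * (Y * V)) =
        (V : Matrix n n ℂ)ᴴ * Y * (U * (U : Matrix n n ℂ)ᴴ) * (Y * V) by
          simp only [Matrix.mul_assoc],
        hUU, Matrix.mul_one, ← Matrix.mul_assoc, Matrix.trace_mul_comm]
      simp only [Matrix.mul_assoc]
    rw [e1, re_trace_conjTranspose_mul_mul_diagonal, Fintype.sum_prod_type,
      Fintype.sum_prod_type_right]
    simp only [hzz]
    simp only [conjTranspose_apply, Complex.star_def, Complex.normSq_conj]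
  have h3 : ∑ z : n × n, l z.2 * Complex.normSq (Z z.1 z.2) = (Y * Y * ρ).trace.re := by
    have e1 : (Y * Y * ρ).trace = (Zᴴ * Z * diagonal (fun j => (l j : ℂ))).trace := by
      rw [hρ, hZ, conjTranspose_mul, conjTranspose_mul, conjTranspose_conjTranspose, hYH]
      rw [show (U : Matrix n n ℂ)ᴴ * (Y * V) * ((V : Matrix n n ℂ)ᴴ * Y * U) =
        (U : Matrix n n ℂ)ᴴ * Y * (V * (V : Matrix n n ℂ)ᴴ) * (Y * U) by
          simp only [Matrix.mul_assoc],
        hVV, Matrix.mul_one, ← Matrix.mul_assoc, Matrix.trace_mul_comm]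
      simp only [Matrix.mul_assoc]
    rw [e1, re_trace_conjTranspose_mul_mul_diagonal]
    simp only [hzz]
  have hK : ∀ τ : Matrix n n ℂ, τ.PosSemidef →
      (Y * Y * τ).trace.re ≤ ∑ i, x i ^ 2 * (E i * τ).trace.re := by
    intro τ hτ
    have := trace_mul_re_nonneg (posSemidef_sum_sq_smul_sub_sq hE x) hτ
    rw [← hY, sub_mul, trace_sub, Complex.sub_re] at this
    have e : ((∑ i, (x i ^ 2 : ℝ) • E i) * τ).trace.re =
        ∑ i, x i ^ 2 * (E i * τ).trace.re := by
      simp only [Finset.sum_mul, trace_sum, smul_mul_assoc, trace_smul, Complex.re_sum,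
        Complex.smul_re, smul_eq_mul]
    linarith
  have hterm : ∀ i, p i ^ 2 / (q i + t * p i) =
      2 * (x i * p i) - (x i ^ 2 * q i + t * (x i ^ 2 * p i)) := by
    intro i
    have hd : 0 ≤ q i + t * p i := by have := hp0 i; have := hq0 i; positivity
    rcases hd.eq_or_lt with h | h
    · simp [hx, ← h]
    · simp only [hx]
      field_simp
      ring
  calc ∑ i, p i ^ 2 / (q i + t * p i)
      = 2 * ∑ i, x i * p i - (∑ i, x i ^ 2 * q i + t * ∑ i, x i ^ 2 * p i) := by
        simp only [hterm, Finset.sum_sub_distrib, Finset.sum_add_distrib, Finset.mul_sum]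
    _ ≤ 2 * ∑ i, x i * p i - ((Y * Y * σ).trace.re + t * (Y * Y * ρ).trace.re) := by
        have := hK σ hσp
        have := mul_le_mul_of_nonneg_left (hK ρ hρp) ht.le
        simp only [hp, hq]
        linarith
    _ = ∑ z : n × n, (2 * (l z.2 * (star (W z.1 z.2) * Z z.1 z.2).re) -
          (m z.1 + t * l z.2) * Complex.normSq (Z z.1 z.2)) := by
        rw [← h1, ← h2, ← h3]
        simp only [Finset.sum_sub_distrib, Finset.sum_add_distrib, Finset.mul_sum, add_mul,
          mul_assoc]
    _ ≤ _ := Finset.sum_le_sum fun z _ => two_mul_re_sub_le (hl _) (hm _) ht _ _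

theorem posSemidef_ptraceR {a b : Type*} [Fintype a] [Fintype b]
    {ρ : Matrix (a × b) (a × b) ℂ} (hρ : ρ.PosSemidef) : (ptraceR ρ).PosSemidef := by
  have : ptraceR ρ = ∑ k, ρ.submatrix (fun i => (i, k)) (fun i => (i, k)) := by
    ext i j
    simp [ptraceR, Matrix.sum_apply]
  rw [this]
  exact posSemidef_sum _ fun k _ => hρ.submatrix _

theorem posSemidef_ptraceL {a b : Type*} [Fintype a] [Fintype b]
    {ρ : Matrix (a × b) (a × b) ℂ} (hρ : ρ.PosSemidef) : (ptraceL ρ).PosSemidef := by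
  have : ptraceL ρ = ∑ k, ρ.submatrix (fun i => (k, i)) (fun i => (k, i)) := by
    ext i j
    simp [ptraceL, Matrix.sum_apply]
  rw [this]
  exact posSemidef_sum _ fun k _ => hρ.submatrix _

theorem trace_kronecker_one_mul {a b : Type*} [Fintype a] [Fintype b] [DecidableEq b]
    (A : Matrix a a ℂ) (ρ : Matrix (a × b) (a × b) ℂ) :
    ((A ⊗ₖ (1 : Matrix b b ℂ)) * ρ).trace = (A * ptraceR ρ).trace := by
  simp only [trace, diag_apply, mul_apply, Fintype.sum_prod_type, kroneckerMap_apply, one_apply,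
    ptraceR, mul_ite, mul_one, mul_zero, ite_mul, zero_mul, Finset.sum_ite_eq,
    Finset.mem_univ, if_true, Finset.mul_sum]
  exact Finset.sum_congr rfl fun _ _ => Finset.sum_comm

theorem trace_one_kronecker_mul {a b : Type*} [Fintype a] [Fintype b] [DecidableEq a]
    (B : Matrix b b ℂ) (ρ : Matrix (a × b) (a × b) ℂ) :
    (((1 : Matrix a a ℂ) ⊗ₖ B) * ρ).trace = (B * ptraceL ρ).trace := by
  simp only [trace, diag_apply, mul_apply, Fintype.sum_prod_type_right, kroneckerMap_apply,
    one_apply, ptraceL, ite_mul, one_mul, zero_mul, Finset.sum_ite_eq,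
    Finset.mem_univ, if_true, Finset.mul_sum]
  exact Finset.sum_congr rfl fun _ _ => Finset.sum_comm

section measProb

variable {a b ι κ : Type*} [Fintype a] [Fintype b] [Fintype ι] [Fintype κ]
    {ρ : Matrix (a × b) (a × b) ℂ} {M : ι → Matrix a a ℂ} {N : κ → Matrix b b ℂ}

theorem sum_measProb_right [DecidableEq b] (hN : ∑ s, N s = 1) (i : ι) :
    ∑ s, measProb ρ M N i s = (M i * ptraceR ρ).trace.re := by
  rw [← trace_kronecker_one_mul, ← hN]
  have : M i ⊗ₖ (∑ s, N s) = ∑ s, M i ⊗ₖ N s := by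
    ext x y
    simp [Matrix.sum_apply, Finset.mul_sum]
  simp only [measProb, this, Finset.sum_mul, trace_sum, Complex.re_sum]

theorem sum_measProb_left [DecidableEq a] (hM : ∑ i, M i = 1) (s : κ) :
    ∑ i, measProb ρ M N i s = (N s * ptraceL ρ).trace.re := by
  rw [← trace_one_kronecker_mul, ← hM]
  have : (∑ i, M i) ⊗ₖ N s = ∑ i, M i ⊗ₖ N s := by
    ext x y
    simp [Matrix.sum_apply, Finset.sum_mul]
  simp only [measProb, this, Finset.sum_mul, trace_sum, Complex.re_sum]

theorem trace_ptraceR : (ptraceR ρ).trace = ρ.trace := by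
  simp [trace, ptraceR, Fintype.sum_prod_type]

theorem sum_measProb [DecidableEq a] [DecidableEq b] (hM : ∑ i, M i = 1) (hN : ∑ s, N s = 1) :
    ∑ z : ι × κ, measProb ρ M N z.1 z.2 = ρ.trace.re := by
  rw [Fintype.sum_prod_type]
  simp only [sum_measProb_right hN]
  rw [← Complex.re_sum, ← trace_sum, ← Finset.sum_mul, hM, one_mul, trace_ptraceR]

theorem IsPOVM.kronecker [DecidableEq a] [DecidableEq b] (hM : IsPOVM M) (hN : IsPOVM N) :
    IsPOVM fun z : ι × κ => M z.1 ⊗ₖ N z.2 := by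
  refine ⟨fun z => (hM.1 z.1).kronecker (hN.1 z.2), ?_⟩
  have : (∑ i, M i) ⊗ₖ (∑ s, N s) = ∑ z : ι × κ, M z.1 ⊗ₖ N z.2 := by
    ext x y
    simp [Matrix.sum_apply, Finset.sum_mul_sum, Fintype.sum_prod_type]
  rw [← this, hM.2, hN.2, one_kronecker_one]

end measProb

theorem isPOVM_unitary_single {n : Type*} [Fintype n] [DecidableEq n] (U : unitaryGroup n ℂ) :
    IsPOVM fun k => (U : Matrix n n ℂ) * single k k 1 * (U : Matrix n n ℂ)ᴴ := by
  have hUU : (U : Matrix n n ℂ) * (U : Matrix n n ℂ)ᴴ = 1 := mem_unitaryGroup_iff.1 U.2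
  refine ⟨fun k => ?_, ?_⟩
  · have h : (single k k 1 : Matrix n n ℂ).PosSemidef := by
      rw [← diagonal_single]
      exact PosSemidef.diagonal (by simp [Pi.single_nonneg])
    exact h.mul_mul_conjTranspose_same _
  · have : ∑ k, (single k k 1 : Matrix n n ℂ) = 1 := by
      simpa using sum_single_eq_diagonal (1 : n → ℂ)
    rw [← Finset.sum_mul, ← Finset.mul_sum, this, Matrix.mul_one, hUU]

theorem trace_unitary_single_mul {n : Type*} [Fintype n] [DecidableEq n]
    (U A : Matrix n n ℂ) (k : n) :
    (U * single k k 1 * Uᴴ * A).trace = (Uᴴ * A * U) k k := by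
  rw [Matrix.mul_assoc, Matrix.mul_assoc, Matrix.trace_mul_comm, Matrix.mul_assoc,
    trace_single_mul]
  simp

theorem trace_eigenvector_single_mul {n : Type*} [Fintype n] [DecidableEq n] {A : Matrix n n ℂ}
    (hA : A.IsHermitian) (k : n) :
    ((hA.eigenvectorUnitary : Matrix n n ℂ) * single k k 1 *
      (hA.eigenvectorUnitary : Matrix n n ℂ)ᴴ * A).trace.re = hA.eigenvalues k := by
  rw [trace_unitary_single_mul]
  have h := mem_unitaryGroup_iff'.1 hA.eigenvectorUnitary.2
  rw [star_eq_conjTranspose] at h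
  set U := (hA.eigenvectorUnitary : Matrix n n ℂ) with hU
  have e : Uᴴ * A * U = diagonal (fun j => (hA.eigenvalues j : ℂ)) := by
    conv_lhs => rw [spectral_eq hA]
    rw [← hU, show Uᴴ * (U * diagonal (fun j => (hA.eigenvalues j : ℂ)) * Uᴴ) * U =
      (Uᴴ * U) * diagonal (fun j => (hA.eigenvalues j : ℂ)) * (Uᴴ * U) by
        simp only [Matrix.mul_assoc], h, Matrix.one_mul, Matrix.mul_one]
  simp [e]

/-- classical mutual information of local measurement outcomes
is at most the quantum mutual information S(A:B). -/
theorem stmt1 {a b ι κ : Type*} [Fintype a] [Fintype b] [Fintype ι] [Fintype κ]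
    [DecidableEq a] [DecidableEq b]
    (ρ : Matrix (a × b) (a × b) ℂ) (hρ : IsDensityMatrix ρ)
    (M : ι → Matrix a a ℂ) (hM : IsPOVM M)
    (N : κ → Matrix b b ℂ) (hN : IsPOVM N) :
    cMutualInfo (measProb ρ M N) ≤ qMutualInfo ρ := by
  have hA := posSemidef_ptraceR hρ.1
  have hB := posSemidef_ptraceL hρ.1
  set l := hρ.1.isHermitian.eigenvalues with hl
  set u := hA.isHermitian.eigenvalues with hu
  set v := hB.isHermitian.eigenvalues with hv
  have hl0 : ∀ j, 0 ≤ l j := hρ.1.eigenvalues_nonneg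
  have hu0 : ∀ j, 0 ≤ u j := hA.eigenvalues_nonneg
  have hv0 : ∀ j, 0 ≤ v j := hB.eigenvalues_nonneg
  set U := hρ.1.isHermitian.eigenvectorUnitary with hU
  set UA := hA.isHermitian.eigenvectorUnitary with hUA
  set UB := hB.isHermitian.eigenvectorUnitary with hUB
  have hUAB : (UA : Matrix a a ℂ) ⊗ₖ (UB : Matrix b b ℂ) ∈ unitaryGroup (a × b) ℂ :=
    kronecker_mem_unitary UA.2 UB.2
  set V : unitaryGroup (a × b) ℂ := ⟨_, hUAB⟩
  have hVc : (V : Matrix (a × b) (a × b) ℂ) = (UA : Matrix a a ℂ) ⊗ₖ (UB : Matrix b b ℂ) := rfl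
  have hσ : ptraceR ρ ⊗ₖ ptraceL ρ = (V : Matrix (a × b) (a × b) ℂ) *
      diagonal (fun k : a × b => ((u k.1 * v k.2 : ℝ) : ℂ)) *
      (V : Matrix (a × b) (a × b) ℂ)ᴴ := by
    rw [hVc, conjTranspose_kronecker]
    conv_lhs => rw [spectral_eq hA.isHermitian, spectral_eq hB.isHermitian]
    simp only [mul_kronecker_mul, diagonal_kronecker_diagonal, Complex.ofReal_mul, hUA, hUB, hu, hv]
  -- the outcome distribution of the measurement in the eigenbases of the marginals
  set R := measProb ρ (fun k => (UA : Matrix a a ℂ) * single k k 1 * (UA : Matrix a a ℂ)ᴴ)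
    (fun k => (UB : Matrix b b ℂ) * single k k 1 * (UB : Matrix b b ℂ)ᴴ) with hR
  have hPA := isPOVM_unitary_single UA
  have hPB := isPOVM_unitary_single UB
  have hRu : ∀ x, ∑ y, R x y = u x := fun x => by
    rw [hR, sum_measProb_right hPB.2, trace_eigenvector_single_mul]
  have hRv : ∀ y, ∑ x, R x y = v y := fun y => by
    rw [hR, sum_measProb_left hPA.2, trace_eigenvector_single_mul]
  have hR0 : ∀ x y, 0 ≤ R x y := fun x y =>
    trace_mul_re_nonneg ((hPA.1 x).kronecker (hPB.1 y)) hρ.1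
  set W := (V : Matrix (a × b) (a × b) ℂ)ᴴ * U with hW
  have hWR : ∀ k, ∑ j, Complex.normSq (W k j) * l j = R k.1 k.2 := by
    intro k
    have e1 : R k.1 k.2 = (((V : Matrix (a × b) (a × b) ℂ)ᴴ * ρ * V) k k).re := by
      rw [← trace_unitary_single_mul, hVc, conjTranspose_kronecker,
        show (single k k 1 : Matrix (a × b) (a × b) ℂ) =
          single k.1 k.1 1 ⊗ₖ single k.2 k.2 1 by simp [single_kronecker_single],
        ← mul_kronecker_mul, ← mul_kronecker_mul]
      rfl
    have e2 : (V : Matrix (a × b) (a × b) ℂ)ᴴ * ρ * V =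
        W * diagonal (fun j => (l j : ℂ)) * Wᴴ := by
      conv_lhs => rw [spectral_eq hρ.1.isHermitian]
      simp only [hW, conjTranspose_mul, conjTranspose_conjTranspose, Matrix.mul_assoc, hU, hl]
    rw [e1, e2, mul_apply, Complex.re_sum]
    refine Finset.sum_congr rfl fun j _ => ?_
    rw [mul_diagonal, conjTranspose_apply, mul_right_comm, Complex.star_def, Complex.mul_conj,
      ← Complex.ofReal_mul, Complex.ofReal_re]
  have hWcol : ∀ j, ∑ k, Complex.normSq (W k j) = 1 := by
    intro j
    have h : Wᴴ * W = 1 := (V⁻¹ * U).2.1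
    have h2 := congrArg Complex.re (congrFun (congrFun h j) j)
    rw [mul_apply, Complex.re_sum, one_apply_eq, Complex.one_re] at h2
    rw [← h2]
    refine Finset.sum_congr rfl fun k _ => ?_
    rw [conjTranspose_apply, Complex.star_def, ← Complex.normSq_eq_conj_mul_self,
      Complex.ofReal_re]
  have hE := hM.kronecker hN
  have hp0 : ∀ i s, 0 ≤ measProb ρ M N i s := fun i s =>
    trace_mul_re_nonneg (hE.1 (i, s)) hρ.1
  set p := measProb ρ M N
  set pa : ι → ℝ := fun i => (M i * ptraceR ρ).trace.re with hpa
  set pb : κ → ℝ := fun s => (N s * ptraceL ρ).trace.re with hpb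
  have hpu : ∀ i, ∑ s, p i s = pa i := fun i => sum_measProb_right hN.2 i
  have hpv : ∀ s, ∑ i, p i s = pb s := fun s => sum_measProb_left hM.2 s
  have hq : ∀ z : ι × κ, ((M z.1 ⊗ₖ N z.2) * (ptraceR ρ ⊗ₖ ptraceL ρ)).trace.re =
      pa z.1 * pb z.2 := by
    intro z
    have him := (Complex.le_def.1 (trace_mul_nonneg (hM.1 z.1) hA)).2
    rw [← mul_kronecker_mul, trace_kronecker, Complex.mul_re, ← him]
    simp [hpa, hpb]
  have hw0 : ∀ k j, 0 ≤ Complex.normSq (W k j) := fun k j => Complex.normSq_nonneg _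
  have hpos : ∀ z : (a × b) × (a × b), Complex.normSq (W z.1 z.2) * l z.2 ≠ 0 →
      0 < Complex.normSq (W z.1 z.2) ∧ 0 < l z.2 ∧ 0 < u z.1.1 * v z.1.2 := by
    rintro ⟨k, j⟩ h
    have h1 := lt_of_le_of_ne (hw0 k j) (left_ne_zero_of_mul h).symm
    have h2 := lt_of_le_of_ne (hl0 j) (right_ne_zero_of_mul h).symm
    have h3 : 0 < R k.1 k.2 := by
      rw [← hWR]
      exact (mul_pos h1 h2).trans_le (Finset.single_le_sum
        (f := fun j => Complex.normSq (W k j) * l j)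
        (fun j _ => mul_nonneg (hw0 k j) (hl0 j)) (Finset.mem_univ j))
    refine ⟨h1, h2, mul_pos (h3.trans_le ?_) (h3.trans_le ?_)⟩
    · rw [← hRu]
      exact Finset.single_le_sum (fun y _ => hR0 k.1 y) (Finset.mem_univ k.2)
    · rw [← hRv]
      exact Finset.single_le_sum (fun x _ => hR0 x k.2) (Finset.mem_univ k.1)
  have hmain := relEntropy_le_of_sum_sq_div_le
    (P := fun z : (a × b) × (a × b) => Complex.normSq (W z.1 z.2) * l z.2)
    (Q := fun z => Complex.normSq (W z.1 z.2) * (u z.1.1 * v z.1.2))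
    (p := fun z : ι × κ => p z.1 z.2) (q := fun z => pa z.1 * pb z.2)
    (fun z => mul_nonneg (hw0 _ _) (hl0 _))
    (fun z hz => mul_pos (hpos z hz).1 (hpos z hz).2.2)
    (fun z => hp0 _ _)
    (fun z hz => by
      have h3 := lt_of_le_of_ne (hp0 z.1 z.2) (Ne.symm hz)
      refine mul_pos (h3.trans_le ?_) (h3.trans_le ?_)
      · rw [← hpu]
        exact Finset.single_le_sum (fun y _ => hp0 z.1 y) (Finset.mem_univ z.2)
      · rw [← hpv]
        exact Finset.single_le_sum (fun x _ => hp0 x z.2) (Finset.mem_univ z.1))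
    (by
      rw [Fintype.sum_prod_type]
      simp only [hWR]
      rw [sum_measProb hM.2 hN.2, sum_measProb hPA.2 hPB.2])
    (fun t ht => by
      refine (le_of_eq ?_).trans ((sum_sq_div_le_of_povm hE U V hl0
        (fun k => mul_nonneg (hu0 k.1) (hv0 k.2)) (spectral_eq hρ.1.isHermitian) hσ ht).trans_eq ?_)
      · simp only [hq]
        rfl
      · refine Finset.sum_congr rfl fun z _ => ?_
        rw [← hW]
        rcases eq_or_ne (Complex.normSq (W z.1 z.2)) 0 with h | h
        · simp [h]
        · rw [mul_left_comm t, ← mul_add, mul_pow, pow_two (Complex.normSq _), mul_assoc,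
            mul_div_mul_left _ _ h])
  have hcl : ∑ z : ι × κ, p z.1 z.2 * (Real.log (p z.1 z.2) - Real.log (pa z.1 * pb z.2)) =
      ∑ z : ι × κ, p z.1 z.2 * Real.log (p z.1 z.2) -
        (∑ i, pa i * Real.log (pa i) + ∑ s, pb s * Real.log (pb s)) := by
    rw [← sum_mul_log_mul_marginals hp0 hpu hpv]
    simp only [mul_sub, Finset.sum_sub_distrib]
  have hqu : ∑ z : (a × b) × (a × b), Complex.normSq (W z.1 z.2) * l z.2 *
      (Real.log (Complex.normSq (W z.1 z.2) * l z.2) -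
        Real.log (Complex.normSq (W z.1 z.2) * (u z.1.1 * v z.1.2))) =
      ∑ j, l j * Real.log (l j) -
        (∑ x, u x * Real.log (u x) + ∑ y, v y * Real.log (v y)) := by
    have h1 : ∀ z : (a × b) × (a × b), Complex.normSq (W z.1 z.2) * l z.2 *
        (Real.log (Complex.normSq (W z.1 z.2) * l z.2) -
          Real.log (Complex.normSq (W z.1 z.2) * (u z.1.1 * v z.1.2))) =
        Complex.normSq (W z.1 z.2) * (l z.2 * Real.log (l z.2)) -
        Complex.normSq (W z.1 z.2) * l z.2 * Real.log (u z.1.1 * v z.1.2) := by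
      intro z
      rcases eq_or_ne (Complex.normSq (W z.1 z.2) * l z.2) 0 with h | h
      · rw [← mul_assoc _ (l z.2) (Real.log (l z.2)), h]
        simp
      · obtain ⟨h1, h2, h3⟩ := hpos z h
        rw [Real.log_mul h1.ne' h2.ne', Real.log_mul h1.ne' h3.ne']
        ring
    rw [← sum_mul_log_mul_marginals hR0 hRu hRv]
    simp only [h1, Finset.sum_sub_distrib]
    congr 1
    · rw [Fintype.sum_prod_type_right]
      simp only [← Finset.sum_mul, hWcol, one_mul]
    · rw [Fintype.sum_prod_type]
      simp only [← Finset.sum_mul, hWR]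
  rw [hcl, hqu] at hmain
  have hlog : 0 < Real.log 2 := Real.log_pos one_lt_two
  simp only [cMutualInfo, qMutualInfo, vnEntropy, dif_pos hρ.1.isHermitian,
    dif_pos hA.isHermitian, dif_pos hB.isHermitian, hpu, hpv, shannon_eq, ← hl, ← hu, ← hv,
    ← add_div, ← sub_div]
  exact div_le_div_of_nonneg_right (by linarith) hlog.le
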